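/- Let N ≥ 1, let Y ⊆ ℝ^N be a closed set, let E ⊆ ℝ^N be a linear subspace, and let A be a linear isometry of ℝ^N (with the Euclidean norm) satisfying A^k = id for some integer k ≥ 1, with A(Y) = Y and A(E) = E. Set X = Y ∪ E and assume X ≠ ℝ^N. Then there exist a function δ : ℝ^N → ℝ with δ ≥ 0 and constants c₁, c₂ > 0, and for every integer j ≥ 1 a constant B_j > 0, such that: (a) δ is continuous on ℝ^N and infinitely differentiable on ℝ^N \ X; (b) c₁·dist(x, X) ≤ δ(x) ≤ c₂·dist(x, X) for all x ∈ ℝ^N; (c) for every j ≥ 1 and every x ∉ X, the norm of the j-th iterated Fréchet derivative of δ at x is at most B_j·dist(x, X)^{1−j}; (d) δ(Ax) = δ(x) for all x ∈ ℝ^N; and (e) δ(x) = dist(x, E) for all x in some open neighborhood of E \ Y. -/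

import Mathlib

/-- Euclidean space `ℝ^N`. -/
abbrev Eu (N : ℕ) : Type := EuclideanSpace ℝ (Fin N)

open Set Filter Topology MeasureTheory
open scoped ContDiff

set_option maxSynthPendingDepth 3 in
/-- Differentiation under the integral sign, to all orders, for a finite measure and uniformly
bounded derivatives. -/
theorem hasFTaylorSeriesUpTo_integral_of_bounded {α E : Type*} [MeasurableSpace α]
    {μ : Measure α} [IsFiniteMeasure μ] [NormedAddCommGroup E] [NormedSpace ℝ E]
    {F : E → α → ℝ} {C : ℕ → ℝ} (hF : ∀ a, ContDiff ℝ ∞ (F · a))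
    (hm : ∀ j x, AEStronglyMeasurable (fun a => iteratedFDeriv ℝ j (F · a) x) μ)
    (hb : ∀ᵐ a ∂μ, ∀ j x, ‖iteratedFDeriv ℝ j (F · a) x‖ ≤ C j) :
    HasFTaylorSeriesUpTo ∞ (fun x => ∫ a, F x a ∂μ)
      (fun x j => ∫ a, iteratedFDeriv ℝ j (F · a) x ∂μ) := by
  have hint : ∀ j x, Integrable (fun a => iteratedFDeriv ℝ j (F · a) x) μ := fun j x =>
    Integrable.of_bound (hm j x) (C j) (hb.mono fun a ha => ha j x)
  have hder : ∀ (j : ℕ) x, HasFDerivAt (fun y => ∫ a, iteratedFDeriv ℝ j (F · a) y ∂μ)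
      (∫ a, iteratedFDeriv ℝ (j + 1) (F · a) x ∂μ).curryLeft x := by
    intro j x
    have hd : ∀ a y, fderiv ℝ (iteratedFDeriv ℝ j (F · a)) y =
        continuousMultilinearCurryLeftEquiv ℝ (fun _ : Fin (j + 1) => E) ℝ
          (iteratedFDeriv ℝ (j + 1) (F · a) y) := fun a y => by
      rw [iteratedFDeriv_succ_eq_comp_left, Function.comp_apply]
      exact (LinearIsometryEquiv.apply_symm_apply _ _).symm
    have hm' : AEStronglyMeasurable (fun a => fderiv ℝ (iteratedFDeriv ℝ j (F · a)) x) μ := by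
      simp_rw [hd]
      exact (LinearIsometryEquiv.continuous _).comp_aestronglyMeasurable (hm (j + 1) x)
    have h := hasFDerivAt_integral_of_dominated_of_fderiv_le (μ := μ) (𝕜 := ℝ)
      (F := fun y a => iteratedFDeriv ℝ j (F · a) y)
      (F' := fun y a => fderiv ℝ (iteratedFDeriv ℝ j (F · a)) y) (x₀ := x)
      (bound := fun _ => C (j + 1)) (s := univ) univ_mem
      (Eventually.of_forall fun y => hm j y) (hint j x) ?_ ?_ (integrable_const _) ?_
    · have heq : (∫ a, iteratedFDeriv ℝ (j + 1) (F · a) x ∂μ).curryLeft =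
          ∫ a, fderiv ℝ (iteratedFDeriv ℝ j (F · a)) x ∂μ := by
        have hint' : Integrable (fun a => fderiv ℝ (iteratedFDeriv ℝ j (F · a)) x) μ := by
          refine Integrable.of_bound hm' (C (j + 1)) (hb.mono fun a ha => ?_)
          rw [norm_fderiv_iteratedFDeriv]
          exact ha (j + 1) x
        ext v m
        rw [ContinuousMultilinearMap.curryLeft_apply,
          ContinuousMultilinearMap.integral_apply (hint (j + 1) x),
          ContinuousLinearMap.integral_apply hint',
          ContinuousMultilinearMap.integral_apply (hint'.apply_continuousLinearMap v)]
        rfl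
      rw [heq]
      exact h
    · exact hm'
    · filter_upwards [hb] with a ha y _
      rw [norm_fderiv_iteratedFDeriv]
      exact ha (j + 1) y
    · filter_upwards with a y _
      exact (((hF a).differentiable_iteratedFDeriv (by exact_mod_cast WithTop.coe_lt_top j)) y).hasFDerivAt
  refine ⟨fun x => ?_, fun j _ x => hder j x, fun j _ => ?_⟩
  · simp only [ContinuousMultilinearMap.curry0]
    rw [ContinuousMultilinearMap.integral_apply (hint 0 x)]
    simp
  · exact continuous_iff_continuousAt.2 fun x => (hder j x).continuousAt

/-- A uniform bound for the derivatives of a composition whose inner function has derivatives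
controlled by powers of a length scale. -/
theorem exists_norm_iteratedFDeriv_comp_le {E F : Type*} [NormedAddCommGroup E] [NormedSpace ℝ E]
    [NormedAddCommGroup F] [NormedSpace ℝ F] {U K : Set F} (hU : IsOpen U) (hK : IsCompact K)
    (hKU : K ⊆ U) {g : F → ℝ} (hg : ContDiffOn ℝ ∞ g U) (b : ℕ → ℝ) :
    ∃ B : ℕ → ℝ, ∀ (f : E → F) (V : Set E) (x : E) (s : ℝ), IsOpen V → x ∈ V →
      ContDiffOn ℝ ∞ f V → 0 < s → f x ∈ K →
      (∀ i, 1 ≤ i → ‖iteratedFDeriv ℝ i f x‖ ≤ b i * s⁻¹ ^ i) →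
      ∀ j, ‖iteratedFDeriv ℝ j (g ∘ f) x‖ ≤ B j * s⁻¹ ^ j := by
  have hC : ∀ i : ℕ, ∃ C, ∀ p ∈ K, ‖iteratedFDerivWithin ℝ i g U p‖ ≤ C := fun i =>
    hK.exists_bound_of_continuousOn
      ((hg.continuousOn_iteratedFDerivWithin (by exact_mod_cast le_top) hU.uniqueDiffOn).mono hKU)
  choose C hC using hC
  refine ⟨fun j => j.factorial * (∑ i ∈ Finset.range (j + 1), |C i|) *
    (1 + ∑ i ∈ Finset.range (j + 1), |b i|) ^ j, fun f V x s hV hx hf hs hfx hb j => ?_⟩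
  have hV' : IsOpen (V ∩ f ⁻¹' U) := hf.continuousOn.isOpen_inter_preimage hV hU
  have hxV' : x ∈ V ∩ f ⁻¹' U := ⟨hx, hKU hfx⟩
  have h := norm_iteratedFDerivWithin_comp_le (n := j) hg (hf.mono inter_subset_left)
    (by exact_mod_cast le_top) hU.uniqueDiffOn hV'.uniqueDiffOn (fun y hy => hy.2) hxV'
    (C := ∑ i ∈ Finset.range (j + 1), |C i|)
    (D := (1 + ∑ i ∈ Finset.range (j + 1), |b i|) * s⁻¹) ?_ ?_
  · rw [iteratedFDerivWithin_of_isOpen j hV' hxV'] at h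
    rwa [mul_pow, ← mul_assoc] at h
  · intro i hi
    exact (hC i _ hfx).trans ((le_abs_self _).trans
      (Finset.single_le_sum (f := fun i => |C i|) (fun _ _ => abs_nonneg _)
        (Finset.mem_range.2 (by lia))))
  · intro i hi hij
    rw [iteratedFDerivWithin_of_isOpen i hV' hxV', mul_pow]
    refine (hb i hi).trans (mul_le_mul_of_nonneg_right ?_ (by positivity))
    have h0 : 0 ≤ ∑ i ∈ Finset.range (j + 1), |b i| := Finset.sum_nonneg fun _ _ => abs_nonneg _
    calc b i ≤ |b i| := le_abs_self _
      _ ≤ ∑ i ∈ Finset.range (j + 1), |b i| :=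
        Finset.single_le_sum (f := fun i => |b i|) (fun _ _ => abs_nonneg _)
          (Finset.mem_range.2 (by lia))
      _ ≤ 1 + ∑ i ∈ Finset.range (j + 1), |b i| := by linarith
      _ ≤ _ := le_self_pow₀ (by linarith) (by lia)

theorem zpow_one_sub_natCast_eq {s : ℝ} (hs : s ≠ 0) (j : ℕ) :
    s ^ (1 - (j : ℤ)) = s * s⁻¹ ^ j := by
  rw [zpow_sub₀ hs, zpow_one, zpow_natCast, inv_pow, div_eq_mul_inv]

/-- Derivative bounds for the composition with a positively homogeneous function, at points whose
rescaled image stays in a compact set. -/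
theorem exists_norm_iteratedFDeriv_homogeneous_comp_le {E F : Type*} [NormedAddCommGroup E]
    [NormedSpace ℝ E] [NormedAddCommGroup F] [NormedSpace ℝ F] {U K : Set F} (hU : IsOpen U)
    (hK : IsCompact K) (hKU : K ⊆ U) {g : F → ℝ} (hg : ContDiffOn ℝ ∞ g U)
    (hhom : ∀ t : ℝ, 0 < t → ∀ p, g (t • p) = t * g p)
    (b : ℕ → ℝ) :
    ∃ B : ℕ → ℝ, ∀ (f : E → F) (V : Set E) (x : E) (s : ℝ), IsOpen V → x ∈ V →
      ContDiffOn ℝ ∞ f V → 0 < s → s⁻¹ • f x ∈ K →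
      (∀ i, 1 ≤ i → ‖iteratedFDeriv ℝ i f x‖ ≤ b i * s ^ (1 - (i : ℤ))) →
      ∀ j, ‖iteratedFDeriv ℝ j (g ∘ f) x‖ ≤ B j * s ^ (1 - (j : ℤ)) := by
  obtain ⟨B, hB⟩ := exists_norm_iteratedFDeriv_comp_le (E := E) hU hK hKU hg b
  refine ⟨B, fun f V x s hV hx hf hs hfx hb j => ?_⟩
  have hfat : ContDiffAt ℝ ∞ f x := hf.contDiffAt (hV.mem_nhds hx)
  have hle : ∀ i : ℕ, (i : WithTop ℕ∞) ≤ ∞ := fun i => by exact_mod_cast le_top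
  have h := hB (fun y => s⁻¹ • f y) V x s hV hx (contDiffOn_const.smul hf) hs hfx (fun i hi => ?_) j
  · have heq : g ∘ f = fun y => s • (g ∘ fun y => s⁻¹ • f y) y := by
      ext y
      simp only [Function.comp_apply, smul_eq_mul, hhom s⁻¹ (inv_pos.2 hs)]
      field_simp
    have hsm : ContDiffAt ℝ ∞ (g ∘ fun y => s⁻¹ • f y) x :=
      ((hg.contDiffAt (hU.mem_nhds (hKU hfx))).comp x (contDiffAt_const.smul hfat))
    rw [heq, iteratedFDeriv_const_smul_apply' (hsm.of_le (hle j)), norm_smul, Real.norm_of_nonneg hs.le,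
      zpow_one_sub_natCast_eq hs.ne']
    nlinarith [mul_le_mul_of_nonneg_left h hs.le]
  · rw [iteratedFDeriv_const_smul_apply' (hfat.of_le (hle i)), norm_smul,
      Real.norm_of_nonneg (inv_nonneg.2 hs.le)]
    have := mul_le_mul_of_nonneg_left (hb i hi) (inv_nonneg.2 hs.le)
    rw [zpow_one_sub_natCast_eq hs.ne'] at this
    refine this.trans (le_of_eq ?_)
    field_simp

theorem Submodule.infDist_eq_norm_starProjection_orthogonal {E : Type*} [NormedAddCommGroup E]
    [InnerProductSpace ℝ E] (W : Submodule ℝ E) [W.HasOrthogonalProjection] (x : E) :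
    Metric.infDist x (W : Set E) = ‖Wᗮ.starProjection x‖ := by
  rw [Submodule.starProjection_orthogonal_val, Submodule.starProjection_minimal,
    Metric.infDist_eq_iInf]
  simp only [dist_eq_norm]
  rfl

/-- The distance to a linear subspace is smooth off the subspace, with the natural derivative
bounds. -/
theorem Submodule.contDiffOn_infDist_and_bounds {E : Type*} [NormedAddCommGroup E]
    [InnerProductSpace ℝ E] [FiniteDimensional ℝ E] (W : Submodule ℝ E) :
    ContDiffOn ℝ ∞ (fun x => Metric.infDist x (W : Set E)) (W : Set E)ᶜ ∧
    ∃ B : ℕ → ℝ, ∀ j, ∀ x ∉ W,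
      ‖iteratedFDeriv ℝ j (fun x => Metric.infDist x (W : Set E)) x‖ ≤
        B j * Metric.infDist x (W : Set E) ^ (1 - (j : ℤ)) := by
  have hpos : ∀ x ∉ W, 0 < Metric.infDist x (W : Set E) := fun x hx =>
    (W.closed_of_finiteDimensional.notMem_iff_infDist_pos ⟨0, W.zero_mem⟩).1 hx
  have heq : (fun x => Metric.infDist x (W : Set E)) = norm ∘ Wᗮ.starProjection :=
    funext W.infDist_eq_norm_starProjection_orthogonal
  have hU : IsOpen ({0}ᶜ : Set E) := isOpen_compl_singleton
  have hg : ContDiffOn ℝ ∞ (norm : E → ℝ) {0}ᶜ := fun x hx =>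
    (contDiffAt_norm ℝ hx).contDiffWithinAt
  refine ⟨?_, ?_⟩
  · rw [heq]
    refine hg.comp Wᗮ.starProjection.contDiff.contDiffOn fun x hx => ?_
    have := hpos x hx
    rw [W.infDist_eq_norm_starProjection_orthogonal] at this
    simpa using this
  · obtain ⟨B, hB⟩ := exists_norm_iteratedFDeriv_homogeneous_comp_le (E := E) hU
      (isCompact_sphere (0 : E) 1) (fun p hp => by
        rintro rfl; simp at hp) hg (fun t ht p => by rw [norm_smul, Real.norm_of_nonneg ht.le]) (fun _ => 1)
    refine ⟨B, fun j x hx => ?_⟩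
    have hs := hpos x hx
    rw [heq]
    refine hB _ univ x _ isOpen_univ (mem_univ _) Wᗮ.starProjection.contDiff.contDiffOn hs ?_ ?_ j
    · rw [mem_sphere_zero_iff_norm, norm_smul, ← W.infDist_eq_norm_starProjection_orthogonal,
        Real.norm_of_nonneg (inv_nonneg.2 hs.le), inv_mul_cancel₀ hs.ne']
    · intro i hi
      obtain rfl | hi := hi.eq_or_lt
      · rw [norm_iteratedFDeriv_one, ContinuousLinearMap.fderiv]
        simpa using Submodule.starProjection_norm_le Wᗮ
      · obtain ⟨i, rfl⟩ : ∃ m, i = m + 2 := ⟨i - 2, by lia⟩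
        rw [← norm_iteratedFDeriv_fderiv]
        have : fderiv ℝ (Wᗮ.starProjection : E → E) = fun _ => Wᗮ.starProjection :=
          funext fun y => ContinuousLinearMap.fderiv _
        rw [this, iteratedFDeriv_succ_const]
        simp only [Pi.zero_apply, norm_zero]
        positivity

section RegularizedDistance

section Cutoff

variable {E : Type*} [NormedAddCommGroup E]

/-- A smooth radial cutoff, equal to `1` on the ball of radius `1/4` and supported in the ball of
radius `1/2`. -/
noncomputable def radialCutoff (z : E) : ℝ := Real.smoothTransition (2 - 16 * ‖z‖ ^ 2)

theorem radialCutoff_nonneg (z : E) : 0 ≤ radialCutoff z := Real.smoothTransition.nonneg _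

theorem radialCutoff_eq_zero {z : E} (hz : 1 / 2 ≤ ‖z‖) : radialCutoff z = 0 :=
  Real.smoothTransition.zero_of_nonpos (by nlinarith)

theorem radialCutoff_eq_one {z : E} (hz : ‖z‖ ≤ 1 / 4) : radialCutoff z = 1 :=
  Real.smoothTransition.one_of_one_le (by nlinarith [norm_nonneg z])

/-- The region in which the kernel is supported, for base points close to `x`. -/
def distShell (Y : Set E) (x : E) : Set E :=
  Metric.ball x (2 * Metric.infDist x Y) ∩ {y | Metric.infDist x Y / 2 ≤ Metric.infDist y Y}

theorem measurableSet_distShell [MeasurableSpace E] [BorelSpace E] (Y : Set E) (x : E) : MeasurableSet (distShell Y x) :=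
  measurableSet_ball.inter
    (isClosed_le continuous_const (Metric.continuous_infDist_pt Y)).measurableSet

end Cutoff

variable {E : Type*} [NormedAddCommGroup E] [InnerProductSpace ℝ E]

theorem contDiff_radialCutoff : ContDiff ℝ ∞ (radialCutoff : E → ℝ) :=
  Real.smoothTransition.contDiff.comp (contDiff_const.sub (contDiff_const.mul (contDiff_norm_sq ℝ)))

theorem exists_norm_iteratedFDeriv_radialCutoff_le [FiniteDimensional ℝ E] :
    ∃ M : ℕ → ℝ, (∀ j, 0 < M j) ∧ ∀ j (z : E), ‖iteratedFDeriv ℝ j radialCutoff z‖ ≤ M j := by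
  have hc : HasCompactSupport (radialCutoff : E → ℝ) :=
    HasCompactSupport.intro (isCompact_closedBall (0 : E) (1 / 2)) fun z hz =>
      radialCutoff_eq_zero (by simpa using (not_le.1 (by simpa using hz)).le)
  have h : ∀ j : ℕ, ∃ C, ∀ z : E, ‖iteratedFDeriv ℝ j radialCutoff z‖ ≤ C := fun j =>
    (hc.iteratedFDeriv j).exists_bound_of_continuous
      (contDiff_radialCutoff.continuous_iteratedFDeriv (by exact_mod_cast le_top))
  choose C hC using h
  exact ⟨fun j => |C j| + 1, fun j => by positivity,
    fun j z => (hC j z).trans ((le_abs_self _).trans (by linarith))⟩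

/-- The kernel whose integral defines the regularized distance. -/
noncomputable def distKernel (Y : Set E) (x y : E) : ℝ :=
  Metric.infDist y Y * (Metric.infDist y Y)⁻¹ ^ Module.finrank ℝ E *
    radialCutoff ((Metric.infDist y Y)⁻¹ • (x - y))

theorem distKernel_nonneg (Y : Set E) (x y : E) : 0 ≤ distKernel Y x y :=
  mul_nonneg (mul_nonneg Metric.infDist_nonneg (pow_nonneg (inv_nonneg.2 Metric.infDist_nonneg) _))
    (radialCutoff_nonneg _)

theorem dist_lt_of_distKernel_ne_zero {Y : Set E} {x y : E} (h : distKernel Y x y ≠ 0) :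
    0 < Metric.infDist y Y ∧ dist x y < Metric.infDist y Y / 2 := by
  have h0 : Metric.infDist y Y ≠ 0 := fun h0 => h (by simp [distKernel, h0])
  have hpos : 0 < Metric.infDist y Y := lt_of_le_of_ne Metric.infDist_nonneg h0.symm
  refine ⟨hpos, ?_⟩
  by_contra! hle
  refine h ?_
  rw [distKernel, radialCutoff_eq_zero, mul_zero]
  rw [norm_smul, Real.norm_of_nonneg (inv_nonneg.2 hpos.le), ← dist_eq_norm, le_inv_mul_iff₀ hpos]
  linarith

theorem distKernel_eq {Y : Set E} {x y : E} (h : 4 * dist x y ≤ Metric.infDist y Y)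
    (hpos : 0 < Metric.infDist y Y) :
    distKernel Y x y = Metric.infDist y Y * (Metric.infDist y Y)⁻¹ ^ Module.finrank ℝ E := by
  rw [distKernel, radialCutoff_eq_one, mul_one]
  rw [norm_smul, Real.norm_of_nonneg (inv_nonneg.2 hpos.le), ← dist_eq_norm, inv_mul_le_iff₀ hpos]
  linarith

theorem contDiff_distKernel (Y : Set E) (y : E) : ContDiff ℝ ∞ (distKernel Y · y) :=
  contDiff_const.mul (contDiff_radialCutoff.comp (contDiff_const.smul (contDiff_id.sub contDiff_const)))

theorem iteratedFDeriv_distKernel (Y : Set E) (j : ℕ) (x y : E) :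
    iteratedFDeriv ℝ j (distKernel Y · y) x =
      (Metric.infDist y Y * (Metric.infDist y Y)⁻¹ ^ Module.finrank ℝ E) •
        (Metric.infDist y Y)⁻¹ ^ j •
          iteratedFDeriv ℝ j radialCutoff ((Metric.infDist y Y)⁻¹ • (x - y)) := by
  have hj : (j : WithTop ℕ∞) ≤ ∞ := by exact_mod_cast le_top
  have hs : ContDiff ℝ j (fun z : E => radialCutoff ((Metric.infDist y Y)⁻¹ • z)) :=
    (contDiff_radialCutoff.of_le hj).comp (contDiff_const.smul contDiff_id)
  have h1 : (distKernel Y · y) = fun x =>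
      (Metric.infDist y Y * (Metric.infDist y Y)⁻¹ ^ Module.finrank ℝ E) •
        (fun z : E => radialCutoff ((Metric.infDist y Y)⁻¹ • z)) (x - y) := rfl
  have hs' : ContDiff ℝ j fun x : E =>
      (fun z : E => radialCutoff ((Metric.infDist y Y)⁻¹ • z)) (x - y) :=
    hs.comp (contDiff_id.sub contDiff_const)
  rw [h1, iteratedFDeriv_const_smul_apply' hs'.contDiffAt,
    iteratedFDeriv_comp_sub (f := fun z : E => radialCutoff ((Metric.infDist y Y)⁻¹ • z)),
    iteratedFDeriv_comp_const_smul _ (contDiff_radialCutoff.of_le hj)]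

theorem distKernel_map {Y : Set E} (L : E ≃ₗᵢ[ℝ] E) (hL : L '' Y = Y) (x y : E) :
    distKernel Y (L x) (L y) = distKernel Y x y := by
  have h : Metric.infDist (L y) Y = Metric.infDist y Y := by
    conv_lhs => rw [← hL]
    exact Metric.infDist_image L.isometry
  simp only [distKernel, radialCutoff, h, ← map_sub, ← map_smul, L.norm_map]

variable [FiniteDimensional ℝ E] [MeasurableSpace E] [BorelSpace E]

/-- The distance to `Y`, regularized by averaging at a scale comparable to the distance. -/
noncomputable def regularizedInfDist (Y : Set E) (x : E) : ℝ := ∫ y, distKernel Y x y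

theorem regularizedInfDist_map {Y : Set E} (L : E ≃ₗᵢ[ℝ] E) (hL : L '' Y = Y) (x : E) :
    regularizedInfDist Y (L x) = regularizedInfDist Y x := by
  rw [regularizedInfDist, ← L.measurePreserving.integral_comp
    L.toHomeomorph.toMeasurableEquiv.measurableEmbedding]
  simp only [distKernel_map L hL]
  rfl

theorem regularizedInfDist_eq_zero {Y : Set E} {x : E} (hx : x ∈ Y) :
    regularizedInfDist Y x = 0 := by
  refine integral_eq_zero_of_ae (Eventually.of_forall fun y => ?_)
  by_contra h
  obtain ⟨h0, h1⟩ := dist_lt_of_distKernel_ne_zero h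
  have := Metric.infDist_le_dist_of_mem (x := y) hx
  rw [dist_comm] at this
  linarith

theorem volume_distShell_lt_top (Y : Set E) (x : E) : volume (distShell Y x) < ⊤ :=
  (measure_mono inter_subset_left).trans_lt measure_ball_lt_top

theorem regularizedInfDist_eq_setIntegral {Y : Set E} {x₀ x : E}
    (hx : 10 * dist x x₀ < Metric.infDist x₀ Y) :
    regularizedInfDist Y x = ∫ y in distShell Y x₀, distKernel Y x y := by
  refine (setIntegral_eq_integral_of_forall_compl_eq_zero fun y hy => ?_).symm
  by_contra h
  obtain ⟨h0, h1⟩ := dist_lt_of_distKernel_ne_zero h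
  have h2 := Metric.infDist_le_infDist_add_dist (s := Y) (x := x₀) (y := x)
  have h3 := Metric.infDist_le_infDist_add_dist (s := Y) (x := x) (y := x₀)
  have h4 := Metric.infDist_le_infDist_add_dist (s := Y) (x := x) (y := y)
  have h5 := Metric.infDist_le_infDist_add_dist (s := Y) (x := y) (y := x)
  have h6 := dist_triangle y x x₀
  rw [dist_comm x₀ x] at h2
  rw [dist_comm y x] at h5 h6
  exact hy ⟨by rw [Metric.mem_ball]; linarith, by rw [mem_ofPred_eq]; linarith⟩

theorem hasFTaylorSeriesUpTo_setIntegral_distKernel {Y : Set E} {x₀ : E} {M : ℕ → ℝ}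
    (hM : ∀ j (z : E), ‖iteratedFDeriv ℝ j radialCutoff z‖ ≤ M j)
    (hx₀ : 0 < Metric.infDist x₀ Y) :
    (∀ y ∈ distShell Y x₀, ∀ j x, ‖iteratedFDeriv ℝ j (distKernel Y · y) x‖ ≤
      3 * Metric.infDist x₀ Y * (2 * (Metric.infDist x₀ Y)⁻¹) ^ (Module.finrank ℝ E + j) * M j) ∧
    HasFTaylorSeriesUpTo ∞ (fun x => ∫ y in distShell Y x₀, distKernel Y x y)
      (fun x j => ∫ y in distShell Y x₀, iteratedFDeriv ℝ j (distKernel Y · y) x) := by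
  have hb : ∀ y ∈ distShell Y x₀, ∀ j x, ‖iteratedFDeriv ℝ j (distKernel Y · y) x‖ ≤
      3 * Metric.infDist x₀ Y * (2 * (Metric.infDist x₀ Y)⁻¹) ^ (Module.finrank ℝ E + j) * M j := by
    rintro y ⟨hy1, hy2⟩ j x
    rw [Metric.mem_ball] at hy1
    rw [mem_ofPred_eq] at hy2
    have h3 := Metric.infDist_le_infDist_add_dist (s := Y) (x := y) (y := x₀)
    have hpos : 0 < Metric.infDist y Y := by linarith
    have hinv : (Metric.infDist y Y)⁻¹ ≤ 2 * (Metric.infDist x₀ Y)⁻¹ := by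
      have := inv_anti₀ (by positivity) hy2
      rwa [inv_div, div_eq_mul_inv] at this
    rw [iteratedFDeriv_distKernel, norm_smul, norm_smul, Real.norm_of_nonneg (by positivity),
      Real.norm_of_nonneg (by positivity), ← mul_assoc, mul_assoc (Metric.infDist y Y), ← pow_add]
    gcongr
    · linarith
    · exact hM j _
  refine ⟨hb, ?_⟩
  have : IsFiniteMeasure (volume.restrict (distShell Y x₀)) :=
    ⟨by rw [Measure.restrict_apply_univ]; exact volume_distShell_lt_top Y x₀⟩
  refine hasFTaylorSeriesUpTo_integral_of_bounded (contDiff_distKernel Y) (fun j x => ?_)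
    ((ae_restrict_iff' (measurableSet_distShell Y x₀)).2 (Eventually.of_forall hb))
  simp_rw [iteratedFDeriv_distKernel]
  have hd : Measurable fun y : E => Metric.infDist y Y :=
    (Metric.continuous_infDist_pt Y).measurable
  have h1 : Measurable fun y : E => (Metric.infDist y Y)⁻¹ • (x - y) :=
    hd.inv.smul (measurable_const.sub measurable_id)
  have h2 : StronglyMeasurable fun y : E =>
      iteratedFDeriv ℝ j radialCutoff ((Metric.infDist y Y)⁻¹ • (x - y)) :=
    ((contDiff_radialCutoff (E := E)).continuous_iteratedFDeriv
      (m := j) (by exact_mod_cast le_top)).stronglyMeasurable.comp_measurable h1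
  exact ((hd.mul (hd.inv.pow_const _)).stronglyMeasurable.smul
    ((hd.inv.pow_const j).stronglyMeasurable.smul h2)).aestronglyMeasurable

theorem contDiffOn_regularizedInfDist {Y : Set E} (hY : IsClosed Y) (hne : Y.Nonempty) :
    ContDiffOn ℝ ∞ (regularizedInfDist Y) Yᶜ := by
  obtain ⟨M, -, hM⟩ := exists_norm_iteratedFDeriv_radialCutoff_le (E := E)
  intro x₀ hx₀
  have hpos := (hY.notMem_iff_infDist_pos hne).1 hx₀
  have h := (hasFTaylorSeriesUpTo_setIntegral_distKernel hM hpos).2.contDiff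
  refine (h.contDiffAt.congr_of_eventuallyEq ?_).contDiffWithinAt
  filter_upwards [Metric.ball_mem_nhds x₀ (show 0 < Metric.infDist x₀ Y / 10 by positivity)]
    with x hx
  rw [Metric.mem_ball] at hx
  exact regularizedInfDist_eq_setIntegral (by linarith)

theorem volumeReal_ball_eq (x : E) {r : ℝ} (hr : 0 < r) :
    volume.real (Metric.ball x r) =
      r ^ Module.finrank ℝ E * volume.real (Metric.ball (0 : E) 1) := by
  rw [Measure.real, Measure.addHaar_ball_of_pos _ _ hr, ENNReal.toReal_mul,
    ENNReal.toReal_ofReal (by positivity)]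
  rfl

theorem exists_norm_iteratedFDeriv_regularizedInfDist_le {Y : Set E} (hY : IsClosed Y)
    (hne : Y.Nonempty) :
    ∃ B : ℕ → ℝ, (∀ j, 0 < B j) ∧ ∀ j, ∀ x ∉ Y, ‖iteratedFDeriv ℝ j (regularizedInfDist Y) x‖ ≤
      B j * Metric.infDist x Y ^ (1 - (j : ℤ)) := by
  obtain ⟨M, hMpos, hM⟩ := exists_norm_iteratedFDeriv_radialCutoff_le (E := E)
  have hω : 0 < volume.real (Metric.ball (0 : E) 1) :=
    ENNReal.toReal_pos (Metric.measure_ball_pos _ _ one_pos).ne' measure_ball_lt_top.ne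
  refine ⟨fun j => 3 * 2 ^ Module.finrank ℝ E * 2 ^ (Module.finrank ℝ E + j) * M j *
    volume.real (Metric.ball (0 : E) 1), fun j => by have := hMpos j; positivity, fun j x hx => ?_⟩
  have hpos := (hY.notMem_iff_infDist_pos hne).1 hx
  obtain ⟨hb, ht⟩ := hasFTaylorSeriesUpTo_setIntegral_distKernel hM hpos
  have heq : regularizedInfDist Y =ᶠ[𝓝 x] fun x' => ∫ y in distShell Y x, distKernel Y x' y := by
    filter_upwards [Metric.ball_mem_nhds x (show 0 < Metric.infDist x Y / 10 by positivity)]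
      with x' hx'
    rw [Metric.mem_ball] at hx'
    exact regularizedInfDist_eq_setIntegral (by linarith)
  rw [(heq.iteratedFDeriv ℝ j).eq_of_nhds,
    ← ht.eq_iteratedFDeriv (m := j) (by exact_mod_cast le_top)]
  refine (norm_setIntegral_le_of_norm_le_const (volume_distShell_lt_top Y x)
    fun y hy => hb y hy j x).trans ?_
  have hvol : volume.real (distShell Y x) ≤
      (2 * Metric.infDist x Y) ^ Module.finrank ℝ E * volume.real (Metric.ball (0 : E) 1) := by
    rw [← volumeReal_ball_eq x (by positivity)]
    exact measureReal_mono inter_subset_left measure_ball_lt_top.ne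
  have := hMpos j
  refine (mul_le_mul_of_nonneg_left hvol (by positivity)).trans (le_of_eq ?_)
  rw [zpow_one_sub_natCast_eq hpos.ne']
  simp only [mul_pow, pow_add, inv_pow]
  field_simp

theorem exists_mul_infDist_le_regularizedInfDist {Y : Set E} (hY : IsClosed Y)
    (hne : Y.Nonempty) :
    ∃ c : ℝ, 0 < c ∧ ∀ x, c * Metric.infDist x Y ≤ regularizedInfDist Y x := by
  obtain ⟨M, hMpos, hM⟩ := exists_norm_iteratedFDeriv_radialCutoff_le (E := E)
  have hω : 0 < volume.real (Metric.ball (0 : E) 1) :=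
    ENNReal.toReal_pos (Metric.measure_ball_pos _ _ one_pos).ne' measure_ball_lt_top.ne
  refine ⟨1 / 2 * (1 / 16) ^ Module.finrank ℝ E * volume.real (Metric.ball (0 : E) 1),
    by positivity, fun x => ?_⟩
  by_cases hx : x ∈ Y
  · rw [Metric.infDist_zero_of_mem hx, regularizedInfDist_eq_zero hx, mul_zero]
  have hpos := (hY.notMem_iff_infDist_pos hne).1 hx
  obtain ⟨hb, ht⟩ := hasFTaylorSeriesUpTo_setIntegral_distKernel hM hpos
  set D := Metric.infDist x Y with hD
  have hball : ∀ y ∈ Metric.ball x (D / 8), 8 * dist x y < D ∧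
      7 * D < 8 * Metric.infDist y Y ∧ 8 * Metric.infDist y Y < 9 * D := fun y hy => by
    rw [Metric.mem_ball] at hy
    have h1 := Metric.infDist_le_infDist_add_dist (s := Y) (x := x) (y := y)
    have h2 := Metric.infDist_le_infDist_add_dist (s := Y) (x := y) (y := x)
    rw [dist_comm x y] at h1 ⊢
    exact ⟨by linarith, by linarith, by linarith⟩
  have hsub : Metric.ball x (D / 8) ⊆ distShell Y x := fun y hy => by
    obtain ⟨h1, h2, h3⟩ := hball y hy
    rw [dist_comm] at h1
    exact ⟨by rw [Metric.mem_ball]; linarith, by rw [mem_ofPred_eq]; linarith⟩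
  have hmeas : AEStronglyMeasurable (fun y => distKernel Y x y) volume := by
    have hd : Measurable fun y : E => Metric.infDist y Y :=
      (Metric.continuous_infDist_pt Y).measurable
    exact ((hd.mul (hd.inv.pow_const _)).mul
      ((contDiff_radialCutoff (E := E)).continuous.measurable.comp
        (hd.inv.smul (measurable_const.sub measurable_id)))).aestronglyMeasurable
  have hint : IntegrableOn (fun y => distKernel Y x y) (distShell Y x) := by
    refine Measure.integrableOn_of_bounded (volume_distShell_lt_top Y x).ne hmeas
      ((ae_restrict_iff' (measurableSet_distShell Y x)).2 (Eventually.of_forall fun y hy => ?_))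
      (M := 3 * D * (2 * D⁻¹) ^ (Module.finrank ℝ E + 0) * M 0)
    have := hb y hy 0 x
    rwa [norm_iteratedFDeriv_zero] at this
  rw [regularizedInfDist_eq_setIntegral (x₀ := x) (x := x) (by simpa using hpos)]
  refine le_trans ?_ (setIntegral_mono_set hint
    (Eventually.of_forall fun y => distKernel_nonneg Y x y) hsub.eventuallyLE)
  have hlow : ∀ y ∈ Metric.ball x (D / 8),
      D / 2 * (2 * D)⁻¹ ^ Module.finrank ℝ E ≤ distKernel Y x y := fun y hy => by
    obtain ⟨h1, h2, h3⟩ := hball y hy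
    have hy0 : 0 < Metric.infDist y Y := by linarith
    rw [distKernel_eq (by linarith) hy0]
    gcongr <;> linarith
  have hk := setIntegral_ge_of_const_le_real measurableSet_ball measure_ball_lt_top.ne hlow
    (hint.mono_set hsub)
  refine le_trans (le_of_eq ?_) hk
  rw [volumeReal_ball_eq x (by positivity), inv_pow, mul_pow, div_pow, div_pow, one_pow]
  field_simp
  rw [← mul_pow]
  norm_num

end RegularizedDistance

/-- A positively homogeneous interpolation between the two coordinates, equal to the first one
where it is the smaller one, and to the second one where it is at most half of the first. -/
noncomputable def blend (p : ℝ × ℝ) : ℝ :=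
  p.2 + Real.smoothTransition ((2 * p.2 - p.1) / p.2) * (p.1 - p.2)

theorem blend_eq_fst {p : ℝ × ℝ} (h0 : 0 < p.2) (h : p.1 ≤ p.2) : blend p = p.1 := by
  rw [blend, Real.smoothTransition.one_of_one_le ((one_le_div h0).2 (by linarith))]
  ring

theorem blend_eq_snd {p : ℝ × ℝ} (h0 : 0 ≤ p.2) (h : 2 * p.2 ≤ p.1) : blend p = p.2 := by
  rw [blend, Real.smoothTransition.zero_of_nonpos (div_nonpos_of_nonpos_of_nonneg (by linarith) h0)]
  ring

theorem blend_smul {t : ℝ} (ht : 0 < t) (p : ℝ × ℝ) : blend (t • p) = t * blend p := by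
  simp only [blend, Prod.smul_fst, Prod.smul_snd, smul_eq_mul]
  rw [show 2 * (t * p.2) - t * p.1 = t * (2 * p.2 - p.1) by ring, mul_div_mul_left _ _ ht.ne']
  ring

theorem blend_bounds {p : ℝ × ℝ} (h1 : 0 ≤ p.1) (h2 : 0 ≤ p.2) :
    min p.1 p.2 ≤ blend p ∧ blend p ≤ p.1 ∧ blend p ≤ 2 * p.2 := by
  rcases le_total (2 * p.2) p.1 with h | h
  · rw [blend_eq_snd h2 h]
    exact ⟨min_le_right _ _, by linarith, by linarith⟩
  rcases h2.eq_or_lt with h0 | h0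
  · rw [blend_eq_snd h2 (by linarith)]
    exact ⟨min_le_right _ _, by linarith, by linarith⟩
  rcases le_total p.1 p.2 with h' | h'
  · rw [blend_eq_fst h0 h']
    exact ⟨min_le_left _ _, le_rfl, by linarith⟩
  · have ht0 := Real.smoothTransition.nonneg ((2 * p.2 - p.1) / p.2)
    have ht1 := Real.smoothTransition.le_one ((2 * p.2 - p.1) / p.2)
    have hle : blend p ≤ p.1 := by rw [blend]; nlinarith
    refine ⟨(min_le_right _ _).trans ?_, hle, by linarith⟩
    rw [blend]; nlinarith

theorem contDiffOn_blend : ContDiffOn ℝ ∞ blend {p | 0 < p.2} := by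
  intro p hp
  have h2 : ContDiffAt ℝ ∞ (Prod.snd : ℝ × ℝ → ℝ) p := contDiffAt_snd
  have h1 : ContDiffAt ℝ ∞ (Prod.fst : ℝ × ℝ → ℝ) p := contDiffAt_fst
  exact (h2.add ((Real.smoothTransition.contDiffAt.comp p
    (((contDiffAt_const.mul h2).sub h1).div h2 (ne_of_gt hp))).mul (h1.sub h2))).contDiffWithinAt

theorem Metric.infDist_union {α : Type*} [PseudoMetricSpace α] {s t : Set α} (hs : s.Nonempty)
    (ht : t.Nonempty) (x : α) : infDist x (s ∪ t) = min (infDist x s) (infDist x t) := by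
  rw [infDist, infEDist_union, infDist, infDist, ENNReal.toReal_min (infEDist_ne_top hs)
    (infEDist_ne_top ht)]

theorem zpow_one_sub_natCast_le {s t : ℝ} (hs : 0 < s) (hst : s ≤ t) {j : ℕ} (hj : 1 ≤ j) :
    t ^ (1 - (j : ℤ)) ≤ s ^ (1 - (j : ℤ)) := by
  obtain ⟨m, rfl⟩ : ∃ m, j = m + 1 := ⟨j - 1, by lia⟩
  rw [show 1 - ((m + 1 : ℕ) : ℤ) = -(m : ℤ) by push_cast; ring, zpow_neg, zpow_neg, zpow_natCast,
    zpow_natCast]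
  gcongr

section

variable {E : Type*} [NormedAddCommGroup E] [InnerProductSpace ℝ E] [FiniteDimensional ℝ E]
  [MeasurableSpace E] [BorelSpace E]

/-- Existence of a regularized distance to a nonempty closed set, invariant under all linear
isometries preserving the set, and bounded above by the distance. -/
theorem exists_regularized_infDist {Y : Set E} (hY : IsClosed Y) (hne : Y.Nonempty) :
    ∃ (r : E → ℝ) (c : ℝ) (B : ℕ → ℝ), 0 < c ∧ (∀ j, 0 < B j) ∧
      (∀ x, c * Metric.infDist x Y ≤ r x) ∧ (∀ x, r x ≤ Metric.infDist x Y) ∧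
      ContDiffOn ℝ ∞ r Yᶜ ∧
      (∀ j, ∀ x ∉ Y, ‖iteratedFDeriv ℝ j r x‖ ≤ B j * Metric.infDist x Y ^ (1 - (j : ℤ))) ∧
      ∀ L : E ≃ₗᵢ[ℝ] E, L '' Y = Y → ∀ x, r (L x) = r x := by
  obtain ⟨B, hBpos, hB⟩ := exists_norm_iteratedFDeriv_regularizedInfDist_le hY hne
  obtain ⟨c, hc, hlow⟩ := exists_mul_infDist_le_regularizedInfDist hY hne
  have hsm := contDiffOn_regularizedInfDist hY hne
  have h0 := hBpos 0
  refine ⟨fun x => (B 0)⁻¹ • regularizedInfDist Y x, (B 0)⁻¹ * c, fun j => (B 0)⁻¹ * B j,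
    by positivity, fun j => by have := hBpos j; positivity, fun x => ?_, fun x => ?_,
    hsm.const_smul _, fun j x hx => ?_, fun L hL x => ?_⟩
  · beta_reduce
    rw [mul_assoc, smul_eq_mul]
    exact mul_le_mul_of_nonneg_left (hlow x) (by positivity)
  · beta_reduce
    by_cases hx : x ∈ Y
    · rw [regularizedInfDist_eq_zero hx, smul_zero]
      exact Metric.infDist_nonneg
    · have h := hB 0 x hx
      rw [norm_iteratedFDeriv_zero] at h
      rw [smul_eq_mul, inv_mul_le_iff₀ h0]
      simpa using (Real.le_norm_self _).trans h
  · have hat : ContDiffAt ℝ j (regularizedInfDist Y) x :=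
      (hsm.contDiffAt (hY.isOpen_compl.mem_nhds hx)).of_le (by exact_mod_cast le_top)
    rw [iteratedFDeriv_const_smul_apply' hat, norm_smul, Real.norm_of_nonneg (by positivity),
      mul_assoc]
    exact mul_le_mul_of_nonneg_left (hB j x hx) (by positivity)
  · beta_reduce
    rw [regularizedInfDist_map L hL]

theorem exists_regularized_infDist_union {Y : Set E} (hY : IsClosed Y) (hne : Y.Nonempty)
    (W : Submodule ℝ E) :
    ∃ (δ : E → ℝ) (c₁ c₂ : ℝ) (B : ℕ → ℝ), 0 < c₁ ∧ 0 < c₂ ∧ (∀ j, 0 < B j) ∧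
      ContDiffOn ℝ ∞ δ (Y ∪ W)ᶜ ∧
      (∀ x, c₁ * Metric.infDist x (Y ∪ W) ≤ δ x ∧ δ x ≤ c₂ * Metric.infDist x (Y ∪ W)) ∧
      (∀ j, 1 ≤ j → ∀ x ∉ Y ∪ (W : Set E),
        ‖iteratedFDeriv ℝ j δ x‖ ≤ B j * Metric.infDist x (Y ∪ W) ^ (1 - (j : ℤ))) ∧
      (∀ L : E ≃ₗᵢ[ℝ] E, L '' Y = Y → L '' W = W → ∀ x, δ (L x) = δ x) ∧
      ∃ O : Set E, IsOpen O ∧ (W : Set E) \ Y ⊆ O ∧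
        ∀ x ∈ O, δ x = Metric.infDist x (W : Set E) := by
  obtain ⟨r, c, Br, hc, hBr, hlow, hup, hrs, hrd, hinv⟩ := exists_regularized_infDist hY hne
  obtain ⟨hWs, BW, hWd⟩ := W.contDiffOn_infDist_and_bounds
  have hWne : (W : Set E).Nonempty := ⟨0, W.zero_mem⟩
  have hWc : IsClosed (W : Set E) := W.closed_of_finiteDimensional
  have hYpos : ∀ x ∉ Y, 0 < Metric.infDist x Y := fun x hx => (hY.notMem_iff_infDist_pos hne).1 hx
  have hWpos : ∀ x ∉ W, 0 < Metric.infDist x (W : Set E) := fun x hx =>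
    (hWc.notMem_iff_infDist_pos hWne).1 hx
  have hrpos : ∀ x ∉ Y, 0 < r x := fun x hx => (mul_pos hc (hYpos x hx)).trans_le (hlow x)
  have hr0 : ∀ x, 0 ≤ r x := fun x => (mul_nonneg hc.le Metric.infDist_nonneg).trans (hlow x)
  have hmin := Metric.infDist_union hne hWne
  have hVo : IsOpen (Y ∪ (W : Set E))ᶜ := (hY.union hWc).isOpen_compl
  have hfs : ContDiffOn ℝ ∞ (fun x => (Metric.infDist x (W : Set E), r x)) (Y ∪ W)ᶜ :=
    (hWs.mono (compl_subset_compl.2 subset_union_right)).prodMk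
      (hrs.mono (compl_subset_compl.2 subset_union_left))
  have hUo : IsOpen {p : ℝ × ℝ | 0 < p.2} := isOpen_lt continuous_const continuous_snd
  obtain ⟨BG, hBG⟩ := exists_norm_iteratedFDeriv_homogeneous_comp_le (E := E) hUo
    ((isCompact_Icc (a := (1 : ℝ)) (b := 2)).prod (isCompact_Icc (a := (1 / 2 : ℝ)) (b := 2)))
    (fun p hp => by
      have := hp.2.1
      rw [mem_ofPred_eq]; linarith) contDiffOn_blend (fun t ht p => blend_smul ht p)
    (fun i => |BW i| + Br i)
  set δ : E → ℝ := blend ∘ fun x => (Metric.infDist x (W : Set E), r x) with hδ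
  have hδb : ∀ x, min (Metric.infDist x (W : Set E)) (r x) ≤ δ x ∧
      δ x ≤ Metric.infDist x (W : Set E) ∧ δ x ≤ 2 * r x := fun x =>
    blend_bounds (p := (Metric.infDist x (W : Set E), r x)) Metric.infDist_nonneg (hr0 x)
  refine ⟨δ, min 1 c, 2, fun j => |BW j| + Br j + |BG j|, by positivity, two_pos,
    fun j => by have := hBr j; positivity, contDiffOn_blend.comp hfs fun x hx =>
      hrpos x fun h => hx (Or.inl h), fun x => ?_, fun j hj x hx => ?_, fun L hLY hLW x => ?_,
    {x | Metric.infDist x (W : Set E) < c * Metric.infDist x Y}, ?_, ?_, fun x hx => ?_⟩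
  · obtain ⟨h1, h2, h3⟩ := hδb x
    rw [hmin]
    have hd0 : 0 ≤ min (Metric.infDist x Y) (Metric.infDist x (W : Set E)) :=
      le_min Metric.infDist_nonneg Metric.infDist_nonneg
    refine ⟨le_trans (le_min ?_ ?_) h1, ?_⟩
    · calc _ ≤ 1 * min (Metric.infDist x Y) (Metric.infDist x (W : Set E)) := by
            gcongr; exact min_le_left _ _
        _ ≤ _ := by rw [one_mul]; exact min_le_right _ _
    · calc _ ≤ c * min (Metric.infDist x Y) (Metric.infDist x (W : Set E)) := by
            gcongr; exact min_le_right _ _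
        _ ≤ c * Metric.infDist x Y := by gcongr; exact min_le_left _ _
        _ ≤ _ := hlow x
    · rw [mul_min_of_nonneg _ _ two_pos.le]
      exact le_min (by linarith [hup x]) (by linarith [Metric.infDist_nonneg (x := x) (s := (W : Set E))])
  · have hxY : x ∉ Y := fun h => hx (Or.inl h)
    have hxW : x ∉ W := fun h => hx (Or.inr h)
    have hdY := hYpos x hxY
    have hdW := hWpos x hxW
    have hrx := hrpos x hxY
    have hupx := hup x
    have hrc : ContinuousAt r x := (hrs.contDiffAt (hY.isOpen_compl.mem_nhds hxY)).continuousAt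
    have hWcont : ContinuousAt (fun x => Metric.infDist x (W : Set E)) x :=
      (Metric.continuous_infDist_pt _).continuousAt
    have hdX : 0 < Metric.infDist x (Y ∪ W) := by rw [hmin]; exact lt_min hdY hdW
    have hXY : Metric.infDist x (Y ∪ W) ≤ Metric.infDist x Y := by rw [hmin]; exact min_le_left _ _
    have hXW : Metric.infDist x (Y ∪ W) ≤ Metric.infDist x (W : Set E) := by
      rw [hmin]; exact min_le_right _ _
    have hz : 0 < Metric.infDist x (Y ∪ W) ^ (1 - (j : ℤ)) := zpow_pos hdX _
    have hBW : ∀ i, 1 ≤ i → ‖iteratedFDeriv ℝ i (fun x => Metric.infDist x (W : Set E)) x‖ ≤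
        |BW i| * Metric.infDist x (Y ∪ W) ^ (1 - (i : ℤ)) := fun i hi =>
      (hWd i x hxW).trans (mul_le_mul (le_abs_self _) (zpow_one_sub_natCast_le hdX hXW hi)
        (zpow_pos hdW _).le (abs_nonneg _))
    have hBrX : ∀ i, 1 ≤ i → ‖iteratedFDeriv ℝ i r x‖ ≤
        Br i * Metric.infDist x (Y ∪ W) ^ (1 - (i : ℤ)) := fun i hi =>
      (hrd i x hxY).trans (mul_le_mul_of_nonneg_left (zpow_one_sub_natCast_le hdX hXY hi)
        (hBr i).le)
    have hsum : ∀ b : ℝ, b ≤ |BW j| + Br j + |BG j| → ‖iteratedFDeriv ℝ j δ x‖ ≤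
        b * Metric.infDist x (Y ∪ W) ^ (1 - (j : ℤ)) → ‖iteratedFDeriv ℝ j δ x‖ ≤
        (|BW j| + Br j + |BG j|) * Metric.infDist x (Y ∪ W) ^ (1 - (j : ℤ)) := fun b hb h =>
      h.trans (mul_le_mul_of_nonneg_right hb hz.le)
    have hBrj := hBr j
    rcases lt_or_ge (Metric.infDist x (W : Set E)) (r x) with h1 | h1
    · have heq : δ =ᶠ[𝓝 x] fun x => Metric.infDist x (W : Set E) := by
        filter_upwards [hWcont.eventually_lt hrc h1, hY.isOpen_compl.mem_nhds hxY] with y hy hyY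
        exact blend_eq_fst (p := (_, _)) (hrpos y hyY) hy.le
      refine hsum |BW j| (by linarith [abs_nonneg (BG j)]) ?_
      rw [(heq.iteratedFDeriv ℝ j).eq_of_nhds]
      exact hBW j hj
    rcases lt_or_ge (2 * r x) (Metric.infDist x (W : Set E)) with h2 | h2
    · have heq : δ =ᶠ[𝓝 x] r := by
        filter_upwards [(continuousAt_const.mul hrc).eventually_lt hWcont h2] with y hy
        exact blend_eq_snd (p := (_, _)) (hr0 y) hy.le
      refine hsum (Br j) (by linarith [abs_nonneg (BG j), abs_nonneg (BW j)]) ?_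
      rw [(heq.iteratedFDeriv ℝ j).eq_of_nhds]
      exact hBrX j hj
    have hW2 : Metric.infDist x (W : Set E) ≤ 2 * Metric.infDist x (Y ∪ W) := by
      rw [hmin, mul_min_of_nonneg _ _ two_pos.le]
      exact le_min (by linarith) (by linarith)
    refine hsum (BG j) (by linarith [le_abs_self (BG j), abs_nonneg (BW j)]) ?_
    refine hBG _ _ x _ hVo hx hfs hdX ?_ (fun i hi => ?_) j
    · simp only [Prod.smul_mk, smul_eq_mul, mem_prod, mem_Icc, le_inv_mul_iff₀ hdX,
        inv_mul_le_iff₀ hdX]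
      exact ⟨⟨by linarith, by linarith⟩, ⟨by linarith, by linarith⟩⟩
    · have hi' : (i : WithTop ℕ∞) ≤ ∞ := by exact_mod_cast le_top
      rw [iteratedFDeriv_prodMk (hWs.contDiffAt (hWc.isOpen_compl.mem_nhds hxW))
        (hrs.contDiffAt (hY.isOpen_compl.mem_nhds hxY)) hi', ContinuousMultilinearMap.opNorm_prod,
        add_mul]
      have hzi : 0 < Metric.infDist x (Y ∪ W) ^ (1 - (i : ℤ)) := zpow_pos hdX _
      have hBri := hBr i
      exact max_le ((hBW i hi).trans (le_add_of_nonneg_right (by positivity)))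
        ((hBrX i hi).trans (le_add_of_nonneg_left (by positivity)))
  · have h : Metric.infDist (L x) (W : Set E) = Metric.infDist x (W : Set E) := by
      conv_lhs => rw [← hLW]
      exact Metric.infDist_image L.isometry
    simp only [hδ, Function.comp_apply, h, hinv L hLY]
  · exact isOpen_lt (Metric.continuous_infDist_pt _)
      (continuous_const.mul (Metric.continuous_infDist_pt _))
  · rintro x ⟨hxW, hxY⟩
    rw [mem_ofPred_eq, Metric.infDist_zero_of_mem hxW]
    exact mul_pos hc (hYpos x hxY)
  · have h := hx.trans_le (hlow x)
    exact blend_eq_fst (p := (_, _)) (Metric.infDist_nonneg.trans_lt h) h.le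

end

theorem continuous_of_continuousOn_compl_of_le_infDist {α : Type*} [PseudoMetricSpace α]
    {X : Set α} (hX : IsClosed X) {δ : α → ℝ} {c : ℝ} (hδ : ContinuousOn δ Xᶜ)
    (h0 : ∀ x, 0 ≤ δ x) (hle : ∀ x, δ x ≤ c * Metric.infDist x X) : Continuous δ := by
  refine continuous_iff_continuousAt.2 fun x => ?_
  by_cases hx : x ∈ X
  · have hlim : Tendsto (fun y => c * Metric.infDist y X) (𝓝 x) (𝓝 0) := by
      have := ((Metric.continuous_infDist_pt X).tendsto x).const_mul c
      rwa [Metric.infDist_zero_of_mem hx, mul_zero] at this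
    have hδx : δ x = 0 := le_antisymm (by simpa [Metric.infDist_zero_of_mem hx] using hle x) (h0 x)
    rw [ContinuousAt, hδx]
    exact squeeze_zero h0 hle hlim
  · exact hδ.continuousAt (hX.isOpen_compl.mem_nhds hx)

/-- Equivariant regularized distance.  Let `Y ⊆ ℝ^N` be closed, `W` a linear subspace,
both invariant under a linear isometry `A` with `A^k = 1`, and `X = Y ∪ W ≠ ℝ^N`.
Then there is a regularized distance function `δ ≥ 0` for `X`: continuous on `ℝ^N`,
smooth off `X`, comparable to `dist(·, X)`, with derivative bounds
`‖D^j δ(x)‖ ≤ B_j · dist(x,X)^{1-j}`, which is `A`-invariant and agrees with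
`dist(·, W)` on a neighborhood of `W \ Y`. -/
theorem stmt16 {N : ℕ} (hN : 1 ≤ N)
    (Y : Set (Eu N)) (hYc : IsClosed Y)
    (W : Submodule ℝ (Eu N))
    (A : Eu N →ₗ[ℝ] Eu N) (hiso : ∀ x, ‖A x‖ = ‖x‖)
    (k : ℕ) (hk : 1 ≤ k) (hAk : A ^ k = 1)
    (hAY : A '' Y = Y) (hAW : A '' (W : Set (Eu N)) = (W : Set (Eu N)))
    (X : Set (Eu N)) (hX : X = Y ∪ (W : Set (Eu N)))
    (hXne : X ≠ Set.univ) :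
    ∃ (δ : Eu N → ℝ) (c₁ c₂ : ℝ) (B : ℕ → ℝ),
      0 < c₁ ∧ 0 < c₂ ∧ (∀ j, 1 ≤ j → 0 < B j) ∧
      (∀ x, 0 ≤ δ x) ∧
      Continuous δ ∧ ContDiffOn ℝ (⊤ : ℕ∞) δ Xᶜ ∧
      (∀ x, c₁ * Metric.infDist x X ≤ δ x ∧ δ x ≤ c₂ * Metric.infDist x X) ∧
      (∀ j, 1 ≤ j → ∀ x ∉ X,
        ‖iteratedFDeriv ℝ j δ x‖ ≤ B j * Metric.infDist x X ^ (1 - (j : ℤ))) ∧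
      (∀ x, δ (A x) = δ x) ∧
      (∃ O : Set (Eu N), IsOpen O ∧ ((W : Set (Eu N)) \ Y) ⊆ O ∧
        ∀ x ∈ O, δ x = Metric.infDist x (W : Set (Eu N))) := by
  have hWc : IsClosed (W : Set (Eu N)) := W.closed_of_finiteDimensional
  let L : Eu N ≃ₗᵢ[ℝ] Eu N := LinearIsometry.toLinearIsometryEquiv ⟨A, hiso⟩ rfl
  have hLA : ⇑L = A := rfl
  subst hX
  obtain ⟨δ, c₁, c₂, B, hc₁, hc₂, hB, hsm, hbd, hder, hinv, hO⟩ :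
      ∃ (δ : Eu N → ℝ) (c₁ c₂ : ℝ) (B : ℕ → ℝ), 0 < c₁ ∧ 0 < c₂ ∧ (∀ j, 0 < B j) ∧
        ContDiffOn ℝ ∞ δ (Y ∪ W)ᶜ ∧
        (∀ x, c₁ * Metric.infDist x (Y ∪ W) ≤ δ x ∧ δ x ≤ c₂ * Metric.infDist x (Y ∪ W)) ∧
        (∀ j, 1 ≤ j → ∀ x ∉ Y ∪ (W : Set (Eu N)),
          ‖iteratedFDeriv ℝ j δ x‖ ≤ B j * Metric.infDist x (Y ∪ W) ^ (1 - (j : ℤ))) ∧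
        (∀ x, δ (A x) = δ x) ∧
        ∃ O : Set (Eu N), IsOpen O ∧ (W : Set (Eu N)) \ Y ⊆ O ∧
          ∀ x ∈ O, δ x = Metric.infDist x (W : Set (Eu N)) := by
    rcases Y.eq_empty_or_nonempty with rfl | hne
    · rw [empty_union]
      obtain ⟨hs, B, hB⟩ := W.contDiffOn_infDist_and_bounds
      refine ⟨fun x => Metric.infDist x (W : Set (Eu N)), 1, 1, fun j => |B j| + 1, one_pos,
        one_pos, fun j => by positivity, hs, fun x => by simp, fun j _ x hx => ?_, fun x => ?_,
        univ, isOpen_univ, subset_univ _, fun x _ => rfl⟩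
      · exact (hB j x hx).trans (mul_le_mul_of_nonneg_right (by linarith [le_abs_self (B j)])
          (zpow_nonneg Metric.infDist_nonneg _))
      · change Metric.infDist (A x) (W : Set (Eu N)) = _
        conv_lhs => rw [← hAW]
        exact Metric.infDist_image L.isometry
    · obtain ⟨δ, c₁, c₂, B, hc₁, hc₂, hB, hsm, hbd, hder, hinv, hO⟩ :=
        exists_regularized_infDist_union hYc hne W
      exact ⟨δ, c₁, c₂, B, hc₁, hc₂, hB, hsm, hbd, hder, hinv L hAY hAW, hO⟩
  have h0 : ∀ x, 0 ≤ δ x := fun x =>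
    (mul_nonneg hc₁.le Metric.infDist_nonneg).trans (hbd x).1
  exact ⟨δ, c₁, c₂, B, hc₁, hc₂, fun j _ => hB j, h0,
    continuous_of_continuousOn_compl_of_le_infDist (hYc.union hWc) hsm.continuousOn h0
      fun x => (hbd x).2, hsm, hbd, hder, hinv, hO⟩
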